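/- arXiv:0711.4052 — 6 statements merged into one kernel-verified Lean document; each statement's English description precedes it below -/
import Mathlib

section
/- Let D be a digraph with a vertex r such that R_D(r) = V(D), and let (u,v) be an arc of D with u ≠ r and v ≠ r. Then (u,v) is not useless for r if and only if there is a dipath from r to u in the digraph D − v obtained from D by deleting the vertex v and all arcs incident to it. -/
/-- A (finite) digraph: a finite vertex set together with a finite set of arcs. -/
structure Dgraph (V : Type*) where
  verts : Finset V
  arcs : Finset (V × V)

variable {V : Type*} [DecidableEq V]

/-- All arcs have both endpoints among the vertices. -/
def DgraphWF (D : Dgraph V) : Prop := ∀ a ∈ D.arcs, a.1 ∈ D.verts ∧ a.2 ∈ D.verts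

/-- `v` is reachable from `u` by a dipath in `D`. -/
def Dgraph.Reaches (D : Dgraph V) (u v : V) : Prop :=
  Relation.ReflTransGen (fun a b => (a, b) ∈ D.arcs) u v

def inDeg (D : Dgraph V) (v : V) : ℕ := (D.arcs.filter (fun a => a.2 = v)).card

def outDeg (D : Dgraph V) (v : V) : ℕ := (D.arcs.filter (fun a => a.1 = v)).card

/-- `T` is an out-tree with root `r`: exactly one vertex (the root) of in-degree 0,
all other vertices of in-degree 1, and (equivalently to being connected and acyclic
as an undirected graph) every vertex is reachable from the root. -/
def IsOutTree (T : Dgraph V) (r : V) : Prop :=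
  (∀ a ∈ T.arcs, a.1 ∈ T.verts ∧ a.2 ∈ T.verts) ∧
  r ∈ T.verts ∧ inDeg T r = 0 ∧
  (∀ v ∈ T.verts, v ≠ r → inDeg T v = 1) ∧
  (∀ v ∈ T.verts, T.Reaches r v)

def IsSubgraph (T D : Dgraph V) : Prop := T.verts ⊆ D.verts ∧ T.arcs ⊆ D.arcs

/-- `T` is an out-branching (a spanning out-tree) of `D` with root `r`. -/
def IsOutBranching (D T : Dgraph V) (r : V) : Prop :=
  IsSubgraph T D ∧ T.verts = D.verts ∧ IsOutTree T r

/-- The set of leaves (vertices of out-degree 0). -/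
def leaves (T : Dgraph V) : Finset V := T.verts.filter (fun v => outDeg T v = 0)

/-- Vertices whose in-neighbor is a branch vertex (a vertex of out-degree at least 2). -/
def brSucc (T : Dgraph V) : Finset V :=
  T.verts.filter (fun v => ∃ a ∈ T.arcs, a.2 = v ∧ 2 ≤ outDeg T a.1)

/-- The 1-change for arc `(u,v)`, where `w` is the in-neighbor of `v` in `T`:
`T + (u,v) - (w,v)`. -/
def oneChange (T : Dgraph V) (u v w : V) : Dgraph V :=
  ⟨T.verts, insert (u, v) (T.arcs.erase (w, v))⟩

/-- `T` is a 1-optimal out-branching of `D` rooted at `r`: no 1-change for an arc of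
`A(D) \ A(T)` results in an out-branching with more leaves. -/
def OneOptimal (D T : Dgraph V) (r : V) : Prop :=
  ∀ u v w, (u, v) ∈ D.arcs → (u, v) ∉ T.arcs → v ≠ r → (w, v) ∈ T.arcs →
    ∀ r', IsOutBranching D (oneChange T u v w) r' →
      (leaves (oneChange T u v w)).card ≤ (leaves T).card

/-- The list of vertices `p` forms a dipath in `D`. -/
def IsDipath (D : Dgraph V) (p : List V) : Prop :=
  p.Nodup ∧ (∀ x ∈ p, x ∈ D.verts) ∧ p.Chain' (fun a b => (a, b) ∈ D.arcs)

/-- Delete a vertex and all incident arcs. -/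
def delVert (D : Dgraph V) (v : V) : Dgraph V :=
  ⟨D.verts.erase v, D.arcs.filter (fun a => a.1 ≠ v ∧ a.2 ≠ v)⟩

open Classical in
/-- `HB_D^T(z,l)`: the heads of arcs `(u,v)` of `D` with `v ≺_T z ⪯_T u ⪯_T l`,
minus `BrSucc(T)`. -/
noncomputable def HBset (D T : Dgraph V) (z l : V) : Finset V :=
  ((D.arcs.filter (fun a =>
      (T.Reaches a.2 z ∧ a.2 ≠ z) ∧ T.Reaches z a.1 ∧ T.Reaches a.1 l)).image Prod.snd)
    \ brSucc T

/-- The consecutive pairs of a list, cyclically (with wraparound). -/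
def cycPairs (c : List V) : List (V × V) := c.zip (c.rotate 1)

theorem DgraphWF.delVert {D : Dgraph V} (hD : DgraphWF D) (v : V) : DgraphWF (delVert D v) := by
  intro a ha
  simp only [_root_.delVert, Finset.mem_filter, Finset.mem_erase] at ha ⊢
  exact ⟨⟨ha.2.1, (hD a ha.1).1⟩, ha.2.2, (hD a ha.1).2⟩

theorem IsSubgraph.trans {D₁ D₂ D₃ : Dgraph V} (h₁₂ : IsSubgraph D₁ D₂) (h₂₃ : IsSubgraph D₂ D₃) :
    IsSubgraph D₁ D₃ :=
  ⟨h₁₂.1.trans h₂₃.1, h₁₂.2.trans h₂₃.2⟩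

theorem delVert_isSubgraph (D : Dgraph V) (v : V) : IsSubgraph (delVert D v) D :=
  ⟨Finset.erase_subset _ _, Finset.filter_subset _ _⟩

theorem Dgraph.Reaches.mono {D D' : Dgraph V} (h : D.arcs ⊆ D'.arcs) {a b : V}
    (hab : D.Reaches a b) : D'.Reaches a b :=
  Relation.ReflTransGen.mono (fun _ _ hxy => h hxy) _ _ hab

/-- The digraph obtained by attaching the vertex `b` to the vertex `a` by the arc `(a, b)`. -/
def attach (T : Dgraph V) (a b : V) : Dgraph V :=
  ⟨insert b T.verts, insert (a, b) T.arcs⟩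

theorem isSubgraph_attach (T : Dgraph V) (a b : V) : IsSubgraph T (attach T a b) :=
  ⟨Finset.subset_insert _ _, Finset.subset_insert _ _⟩

theorem IsSubgraph.attach {T D : Dgraph V} (h : IsSubgraph T D) (hD : DgraphWF D) {a b : V}
    (hab : (a, b) ∈ D.arcs) : IsSubgraph (attach T a b) D :=
  ⟨Finset.insert_subset (hD _ hab).2 h.1, Finset.insert_subset hab h.2⟩

theorem inDeg_attach_of_ne (T : Dgraph V) {a b x : V} (h : b ≠ x) :
    inDeg (attach T a b) x = inDeg T x := by
  simp [inDeg, attach, Finset.filter_insert, h]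

theorem isOutTree_singleton (r : V) : IsOutTree (⟨{r}, ∅⟩ : Dgraph V) r := by
  refine ⟨by simp, by simp, by simp [inDeg], by simp, ?_⟩
  intro x hx
  obtain rfl : x = r := by simpa using hx
  exact Relation.ReflTransGen.refl

theorem IsOutTree.attach {T : Dgraph V} {r a b : V} (hT : IsOutTree T r)
    (ha : a ∈ T.verts) (hb : b ∉ T.verts) : IsOutTree (attach T a b) r := by
  have hsub := isSubgraph_attach T a b
  obtain ⟨hwf, hr, hr0, hdeg, hreach⟩ := hT
  refine ⟨?_, hsub.1 hr, ?_, ?_, ?_⟩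
  · intro e he
    rcases Finset.mem_insert.1 he with rfl | he
    · exact ⟨hsub.1 ha, Finset.mem_insert_self _ _⟩
    · exact ⟨hsub.1 (hwf e he).1, hsub.1 (hwf e he).2⟩
  · rw [inDeg_attach_of_ne T (ne_of_mem_of_not_mem hr hb).symm, hr0]
  · intro x hx hxr
    rcases Finset.mem_insert.1 hx with rfl | hx
    · have h : T.arcs.filter (fun e => e.2 = x) = ∅ :=
        Finset.filter_eq_empty_iff.2 fun e he hex => hb (hex ▸ (hwf e he).2)
      simp [inDeg, _root_.attach, Finset.filter_insert, h]
    · rw [inDeg_attach_of_ne T (ne_of_mem_of_not_mem hx hb).symm, hdeg x hx hxr]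
  · intro x hx
    rcases Finset.mem_insert.1 hx with rfl | hx
    · exact ((hreach a ha).mono hsub.2).tail (Finset.mem_insert_self _ _)
    · exact (hreach x hx).mono hsub.2

theorem IsOutTree.not_mem_arcs_root {T : Dgraph V} {r a : V} (hT : IsOutTree T r) :
    (a, r) ∉ T.arcs := fun h =>
  Finset.filter_eq_empty_iff.1 (Finset.card_eq_zero.1 hT.2.2.1) h rfl

theorem IsOutTree.inNeighbor_unique {T : Dgraph V} {r a b c : V} (hT : IsOutTree T r)
    (ha : (a, c) ∈ T.arcs) (hb : (b, c) ∈ T.arcs) : a = b := by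
  have hc : c ≠ r := by
    rintro rfl
    exact hT.not_mem_arcs_root ha
  have h := Finset.card_le_one.1 (hT.2.2.2.1 c (hT.1 _ ha).2 hc).le
    (a, c) (by simp [ha]) (b, c) (by simp [hb])
  exact congrArg Prod.fst h

/-- The tail of an arc of an out-tree is not reachable from its head. -/
theorem IsOutTree.not_reaches_tail {T : Dgraph V} {r u v : V} (hT : IsOutTree T r)
    (huv : (u, v) ∈ T.arcs) : ¬ T.Reaches v u := by
  intro hvu
  have key : ∀ x, T.Reaches x v → T.Reaches v x := by
    intro x hx
    induction hx using Relation.ReflTransGen.head_induction_on with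
    | refl => exact Relation.ReflTransGen.refl
    | head hac _ ih =>
      rcases Relation.ReflTransGen.cases_tail ih with rfl | ⟨b, hb, hbc⟩
      · exact hT.inNeighbor_unique huv hac ▸ hvu
      · exact hT.inNeighbor_unique hbc hac ▸ hb
  have hvr := key r (hT.2.2.2.2 v (hT.1 _ huv).2)
  rcases Relation.ReflTransGen.cases_tail hvr with rfl | ⟨b, -, hb⟩
  · exact hT.not_mem_arcs_root huv
  · exact hT.not_mem_arcs_root hb

/-- An out-tree in `D` extends to an out-tree containing any vertex reachable from the root. -/
theorem IsOutTree.exists_extend_mem {D T : Dgraph V} {r x : V} (hD : DgraphWF D)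
    (hT : IsOutTree T r) (hTD : IsSubgraph T D) (hx : D.Reaches r x) :
    ∃ T', IsOutTree T' r ∧ IsSubgraph T' D ∧ IsSubgraph T T' ∧ x ∈ T'.verts := by
  induction hx with
  | refl => exact ⟨T, hT, hTD, ⟨subset_rfl, subset_rfl⟩, hT.2.1⟩
  | @tail a b _ hab ih =>
    obtain ⟨T', hT', hT'D, hTT', ha⟩ := ih
    by_cases hb : b ∈ T'.verts
    · exact ⟨T', hT', hT'D, hTT', hb⟩
    · exact ⟨_, hT'.attach ha hb, hT'D.attach hD hab,
        hTT'.trans (isSubgraph_attach T' a b), Finset.mem_insert_self _ _⟩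

theorem IsOutTree.exists_extend_subset {D T : Dgraph V} {r : V} (hD : DgraphWF D)
    (hT : IsOutTree T r) (hTD : IsSubgraph T D) (s : Finset V) (hs : ∀ x ∈ s, D.Reaches r x) :
    ∃ T', IsOutTree T' r ∧ IsSubgraph T' D ∧ IsSubgraph T T' ∧ s ⊆ T'.verts := by
  induction s using Finset.induction_on with
  | empty => exact ⟨T, hT, hTD, ⟨subset_rfl, subset_rfl⟩, Finset.empty_subset _⟩
  | insert x s _ ih =>
    obtain ⟨T₁, hT₁, hT₁D, hTT₁, hs₁⟩ := ih fun y hy => hs y (Finset.mem_insert_of_mem hy)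
    obtain ⟨T₂, hT₂, hT₂D, hT₁T₂, hx⟩ :=
      hT₁.exists_extend_mem hD hT₁D (hs x (Finset.mem_insert_self _ _))
    exact ⟨T₂, hT₂, hT₂D, hTT₁.trans hT₁T₂, Finset.insert_subset hx (hs₁.trans hT₁T₂.1)⟩

/-- A vertex reachable from `r ≠ v` is reachable in `D - v` or is reachable from `v`. -/
theorem Dgraph.Reaches.delVert_or {D : Dgraph V} {r v x : V} (hvr : v ≠ r)
    (hx : D.Reaches r x) : (x ≠ v ∧ (delVert D v).Reaches r x) ∨ D.Reaches v x := by
  induction hx with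
  | refl => exact Or.inl ⟨hvr.symm, Relation.ReflTransGen.refl⟩
  | @tail a b _ hab ih =>
    rcases ih with ⟨hav, ha⟩ | ha
    · by_cases hbv : b = v
      · subst hbv
        exact Or.inr Relation.ReflTransGen.refl
      · exact Or.inl ⟨hbv, ha.tail (by simp [delVert, hab, hav, hbv])⟩
    · exact Or.inr (ha.tail hab)

/-- Let `D` be a digraph with `R_D(r) = V(D)` and let `(u,v)` be an
arc of `D` with `u ≠ r` and `v ≠ r`. Then `(u,v)` is not useless for `r` iff
there is a dipath from `r` to `u` in `D − v`. -/
theorem not_useless_iff_reaches_in_delVert {V : Type*} [DecidableEq V]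
    (D : Dgraph V) (r u v : V) (hwf : DgraphWF D) (hr : r ∈ D.verts)
    (hreach : ∀ x ∈ D.verts, D.Reaches r x) (ha : (u, v) ∈ D.arcs)
    (hur : u ≠ r) (hvr : v ≠ r) :
    (∃ T : Dgraph V, IsOutBranching D T r ∧ (u, v) ∈ T.arcs) ↔
      (delVert D v).Reaches r u := by
  constructor
  · rintro ⟨T, ⟨hTD, -, hT⟩, huv⟩
    rcases (hT.2.2.2.2 u (hT.1 _ huv).1).delVert_or hvr with ⟨-, h⟩ | h
    · exact h.mono (Finset.filter_subset_filter _ hTD.2)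
    · exact absurd h (hT.not_reaches_tail huv)
  · intro h
    obtain ⟨T₁, hT₁, hT₁D, -, hu⟩ := (isOutTree_singleton r).exists_extend_mem (hwf.delVert v)
      ⟨by simp [delVert, hr, hvr.symm], by simp⟩ h
    have hv : v ∉ T₁.verts := fun hv => Finset.notMem_erase v D.verts (hT₁D.1 hv)
    obtain ⟨T, hT, hTD, hT₁T, hverts⟩ := (hT₁.attach hu hv).exists_extend_subset hwf
      ((hT₁D.trans (delVert_isSubgraph D v)).attach hwf ha) D.verts hreach
    exact ⟨T, ⟨hTD, hTD.1.antisymm hverts, hT⟩, hT₁T.2 (Finset.mem_insert_self _ _)⟩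
end

section
/- Let T be an out-branching of a digraph D, and let (u,v) ∈ A(D)∖A(T) with v not the root of T. The 1-change for (u,v) increases the number of leaves (i.e., the resulting digraph has strictly more vertices of out-degree 0 than T) if and only if u ∉ Leaf(T) and v ∉ BrSucc(T). -/
variable {V : Type*} [DecidableEq V]

/-- The tail of an arc has positive out-degree. -/
lemma outDeg_pos {T : Dgraph V} {w v : V} (hw : (w, v) ∈ T.arcs) : 0 < outDeg T w :=
  Finset.card_pos.2 ⟨(w, v), by simp [hw]⟩

/-- A 1-change raises the out-degree of the new in-neighbor by one, lowers that of the old one by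
one, and leaves all other out-degrees unchanged. -/
lemma outDeg_oneChange {T : Dgraph V} {u v w : V} (haT : (u, v) ∉ T.arcs)
    (hw : (w, v) ∈ T.arcs) (x : V) :
    outDeg (oneChange T u v w) x + (if w = x then 1 else 0) =
      outDeg T x + (if u = x then 1 else 0) := by
  have hne : (u, v) ∉ T.arcs.erase (w, v) := fun h => haT (Finset.mem_of_mem_erase h)
  simp only [outDeg, oneChange, Finset.card_filter]
  rw [Finset.sum_insert hne, add_assoc, Finset.sum_erase_add _ _ hw, add_comm]

/-- If `v` has in-degree one, then `v` lies in `brSucc T` exactly when its in-neighbor is a branch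
vertex. -/
lemma mem_brSucc_iff_of_inDeg_eq_one {T : Dgraph V} {v w : V} (hv : v ∈ T.verts)
    (hw : (w, v) ∈ T.arcs) (hin : inDeg T v = 1) : v ∈ brSucc T ↔ 2 ≤ outDeg T w := by
  simp only [brSucc, Finset.mem_filter, hv, true_and]
  constructor
  · rintro ⟨a, ha, hav, hdeg⟩
    have : a = (w, v) :=
      Finset.card_le_one.1 hin.le a (by simp [ha, hav]) (w, v) (by simp [hw])
    rwa [this] at hdeg
  · exact fun h => ⟨(w, v), hw, rfl, h⟩

lemma leaves_oneChange_of_two_le {T : Dgraph V} {u v w : V} (haT : (u, v) ∉ T.arcs)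
    (hw : (w, v) ∈ T.arcs) (hdeg : 2 ≤ outDeg T w) :
    leaves (oneChange T u v w) = (leaves T).erase u := by
  ext x
  have h := outDeg_oneChange haT hw x
  have huw : u ≠ w := fun h => haT (h ▸ hw)
  have hverts : (oneChange T u v w).verts = T.verts := rfl
  simp only [leaves, Finset.mem_filter, Finset.mem_erase, hverts]
  grind

lemma leaves_oneChange_of_outDeg_eq_one {T : Dgraph V} {u v w : V} (haT : (u, v) ∉ T.arcs)
    (hw : (w, v) ∈ T.arcs) (hwT : w ∈ T.verts) (hdeg : outDeg T w = 1) :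
    leaves (oneChange T u v w) = insert w ((leaves T).erase u) := by
  ext x
  have h := outDeg_oneChange haT hw x
  have huw : u ≠ w := fun h => haT (h ▸ hw)
  have hverts : (oneChange T u v w).verts = T.verts := rfl
  simp only [leaves, Finset.mem_filter, Finset.mem_erase, Finset.mem_insert, hverts]
  grind

/-- Let `T` be an out-branching of `D` and `(u,v) ∈ A(D) \ A(T)`
with `v` not the root. The 1-change for `(u,v)` increases the number of leaves
iff `u ∉ Leaf(T)` and `v ∉ BrSucc(T)`. -/
theorem oneChange_increases_leaves_iff {V : Type*} [DecidableEq V]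
    (D T : Dgraph V) (r u v w : V) (hwf : DgraphWF D)
    (hT : IsOutBranching D T r) (haD : (u, v) ∈ D.arcs) (haT : (u, v) ∉ T.arcs)
    (hvr : v ≠ r) (hw : (w, v) ∈ T.arcs) :
    (leaves T).card < (leaves (oneChange T u v w)).card ↔
      (u ∉ leaves T ∧ v ∉ brSucc T) := by
  obtain ⟨-, -, harcs, -, -, hin, -⟩ := hT
  have hwT : w ∈ T.verts := (harcs _ hw).1
  have hvT : v ∈ T.verts := (harcs _ hw).2
  rw [mem_brSucc_iff_of_inDeg_eq_one hvT hw (hin v hvT hvr)]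
  have hpos : 0 < outDeg T w := outDeg_pos hw
  have hleaf : w ∉ leaves T := by
    simp only [leaves, Finset.mem_filter, not_and]
    omega
  by_cases hbr : 2 ≤ outDeg T w
  · rw [leaves_oneChange_of_two_le haT hw hbr]
    have := Finset.card_erase_le (s := leaves T) (a := u)
    simp only [hbr, not_true_eq_false, and_false, iff_false, not_lt]
    exact this
  · rw [leaves_oneChange_of_outDeg_eq_one haT hw hwT (by omega),
      Finset.card_insert_of_notMem (fun h => hleaf (Finset.mem_of_mem_erase h))]
    by_cases hu : u ∈ leaves T
    · simp only [hu, not_true_eq_false, false_and, iff_false, not_lt]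
      exact (Finset.card_erase_add_one hu).le
    · simp [hu, hbr]
end

section
/- Let T be an out-branching of a digraph D and let Q be a dipath in D that starts at the root r of T. Then successively making the 1-changes for every arc in A(Q)∖A(T) yields again an out-branching of D, and this out-branching contains Q (i.e., A(Q) is contained in its arc set). -/
variable {V : Type*} [DecidableEq V]

theorem List.IsChain.rel_of_mem_zip_tail {α : Type*} {R : α → α → Prop} {l : List α}
    (h : l.IsChain R) {a b : α} (hab : (a, b) ∈ l.zip l.tail) : R a b := by
  induction h with
  | nil => simp at hab
  | singleton => simp at hab
  | cons_cons hr _ ih =>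
    simp only [List.tail_cons, List.zip_cons_cons, List.mem_cons, Prod.mk.injEq] at hab ih
    rcases hab with ⟨rfl, rfl⟩ | hab
    · exact hr
    · exact ih hab

theorem List.Nodup.left_eq_of_mem_zip {α β : Type*} {m : List α} {l : List β} (hl : l.Nodup)
    {a a' : α} {b : β} (h : (a, b) ∈ m.zip l) (h' : (a', b) ∈ m.zip l) : a = a' := by
  induction l generalizing m with
  | nil => simp at h
  | cons c l ih =>
    cases m with
    | nil => simp at h
    | cons d m =>
      simp only [List.zip_cons_cons, List.mem_cons, Prod.mk.injEq] at h h'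
      rw [List.nodup_cons] at hl
      rcases h with ⟨rfl, rfl⟩ | h <;> rcases h' with ⟨rfl, h2⟩ | h'
      · rfl
      · exact absurd (List.of_mem_zip h').2 hl.1
      · exact absurd (h2 ▸ (List.of_mem_zip h).2) hl.1
      · exact ih hl.2 h h'

theorem List.reflTransGen_of_zip {α : Type*} {R : α → α → Prop} {r : α} {l : List α}
    (h : ∀ a b, (a, b) ∈ (r :: l).zip l → R a b) {v : α} (hv : v ∈ r :: l) :
    Relation.ReflTransGen R r v := by
  induction l generalizing r with
  | nil =>
    obtain rfl : v = r := by simpa using hv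
    exact .refl
  | cons c l ih =>
    rcases List.mem_cons.1 hv with rfl | hv
    · exact .refl
    · exact .head (h r c (by simp)) (ih (fun a b hab => h a b (by simp [hab])) hv)

/-- Let `T` be an out-branching of `D` and let `Q` be a dipath in
`D` that starts at the root `r` of `T`. Then successively making the 1-changes
for every arc in `A(Q) \ A(T)` (i.e. replacing, for every such arc `(u,v)`, the
`T`-arc into `v` by `(u,v)`) yields again an out-branching of `D`, which
contains `Q`. -/
theorem oneChanges_along_root_dipath {V : Type*} [DecidableEq V]
    (D T : Dgraph V) (r : V) (hwf : DgraphWF D) (hT : IsOutBranching D T r)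
    (q : List V) (hq : IsDipath D q) (hstart : q.head? = some r) :
    ∃ T' : Dgraph V,
      T'.verts = T.verts ∧
      T'.arcs =
        (T.arcs.filter
          (fun a => a.2 ∉ (((q.zip q.tail).toFinset \ T.arcs).image Prod.snd))) ∪
        ((q.zip q.tail).toFinset \ T.arcs) ∧
      IsOutBranching D T' r ∧ (q.zip q.tail).toFinset ⊆ T'.arcs := by
  obtain ⟨⟨-, hTD⟩, hverts, hTarcs, hr, hr0, hdeg, hreach⟩ := hT
  obtain ⟨hnd, -, hch⟩ := hq
  obtain ⟨l, rfl⟩ : ∃ l, q = r :: l := by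
    cases q with
    | nil => simp at hstart
    | cons a l => exact ⟨l, by simpa using hstart⟩
  have hQD : ∀ a ∈ (r :: l).zip l, a ∈ D.arcs := fun a ha => hch.rel_of_mem_zip_tail ha
  rw [List.nodup_cons] at hnd
  have huniq : ∀ {a a' b}, (a, b) ∈ (r :: l).zip l → (a', b) ∈ (r :: l).zip l → a = a' :=
    fun h h' => hnd.2.left_eq_of_mem_zip h h'
  simp only [List.tail_cons]
  set N := ((r :: l).zip l).toFinset \ T.arcs with hN
  have hmemN : ∀ a, a ∈ N ↔ a ∈ (r :: l).zip l ∧ a ∉ T.arcs := by simp [hN]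
  set A := (T.arcs.filter (fun a => a.2 ∉ N.image Prod.snd)) ∪ N with hA
  have hmemA : ∀ a, a ∈ A ↔ (a ∈ T.arcs ∧ ∀ u, (u, a.2) ∉ N) ∨ a ∈ N := by simp [hA]
  have hQA : ∀ a ∈ (r :: l).zip l, a ∈ A := by
    rintro ⟨u, v⟩ ha
    by_cases hT : (u, v) ∈ T.arcs
    · refine (hmemA _).2 (.inl ⟨hT, fun u' hu' => ?_⟩)
      obtain ⟨h1, h2⟩ := (hmemN _).1 hu'
      exact h2 (huniq ha h1 ▸ hT)
    · exact (hmemA _).2 (.inr ((hmemN _).2 ⟨ha, hT⟩))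
  have hAD : A ⊆ D.arcs := by
    intro a ha
    rcases (hmemA a).1 ha with h | h
    · exact hTD h.1
    · exact hQD a ((hmemN a).1 h).1
  refine ⟨⟨T.verts, A⟩, rfl, rfl, ⟨⟨hverts.le, hAD⟩, hverts, ?_, hr, ?_, ?_, ?_⟩, ?_⟩
  · intro a ha
    rw [hverts]
    exact hwf a (hAD ha)
  · rw [inDeg, Finset.card_eq_zero, Finset.filter_eq_empty_iff] at hr0 ⊢
    rintro ⟨u, v⟩ ha rfl
    rcases (hmemA _).1 ha with h | h
    · exact hr0 h.1 rfl
    · exact hnd.1 (List.of_mem_zip ((hmemN _).1 h).1).2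
  · intro v hv hvr
    by_cases h : ∃ u, (u, v) ∈ N
    · obtain ⟨u, hu⟩ := h
      refine Finset.card_eq_one.2 ⟨(u, v), Finset.eq_singleton_iff_unique_mem.2
        ⟨Finset.mem_filter.2 ⟨(hmemA _).2 (.inr hu), rfl⟩, ?_⟩⟩
      rintro ⟨u', v'⟩ hmem
      obtain ⟨ha, rfl⟩ := Finset.mem_filter.1 hmem
      rcases (hmemA _).1 ha with h | h
      · exact absurd hu (h.2 u)
      · rw [huniq ((hmemN _).1 h).1 ((hmemN _).1 hu).1]
    · push Not at h
      rw [← hdeg v hv hvr, inDeg, inDeg]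
      congr 1
      ext ⟨u, w⟩
      simp only [Finset.mem_filter, hmemA]
      constructor
      · rintro ⟨h1 | h1, rfl⟩
        · exact ⟨h1.1, rfl⟩
        · exact absurd h1 (h u)
      · rintro ⟨h1, rfl⟩
        exact ⟨.inl ⟨h1, h⟩, rfl⟩
  · intro v hv
    have hQ : ∀ v ∈ r :: l, Relation.ReflTransGen (fun a b => (a, b) ∈ A) r v :=
      fun v hv => List.reflTransGen_of_zip (fun a b hab => hQA _ hab) hv
    have hv' := hreach v hv
    clear hv
    unfold Dgraph.Reaches at hv' ⊢
    induction hv' with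
    | refl => exact .refl
    | @tail b c _ hbc ih =>
      by_cases h : ∃ u, (u, c) ∈ N
      · obtain ⟨u, hu⟩ := h
        exact hQ c (List.mem_cons_of_mem _ (List.of_mem_zip ((hmemN _).1 hu).1).2)
      · push Not at h
        exact ih.tail ((hmemA _).2 (.inl ⟨hbc, h⟩))
  · intro a ha
    exact hQA a (List.mem_toFinset.1 ha)
end

section
/- Let ⪯ be a linear order (with corresponding strict order ≺) on a finite set L ∪ R, where L and R are disjoint and v ∈ L, u ∈ R imply v ≺ u. Let B be a set of at least 2k−1 ordered pairs (u,v) with u ∈ R and v ∈ L, and let W ⊆ L ∪ R be a set such that for every pair (u,v) ∈ B there is a w ∈ W with v ≺ w ⪯ u. Then there exists a w ∈ W such that there are at least k pairs (x,y) ∈ B with y ≺ w ⪯ x. -/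
variable {V : Type*} [DecidableEq V]

/-- Let `⪯` be a linear order on the finite set `L ∪ R`, with `L`,
`R` disjoint and every element of `L` strictly below every element of `R`. Let
`B` be a set of at least `2k−1` pairs `(u,v)` with `u ∈ R`, `v ∈ L`, and let
`W ⊆ L ∪ R` be such that every pair `(u,v) ∈ B` has some `w ∈ W` with
`v ≺ w ⪯ u`. Then some `w ∈ W` has at least `k` pairs `(x,y) ∈ B` with
`y ≺ w ⪯ x`. -/
theorem exists_middle_element {α : Type*} [LinearOrder α] [DecidableEq α]
    (L R W : Finset α) (B : Finset (α × α)) (k : ℕ) (hk : 1 ≤ k)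
    (hdisj : Disjoint L R) (hLR : ∀ v ∈ L, ∀ u ∈ R, v < u)
    (hB : ∀ p ∈ B, p.1 ∈ R ∧ p.2 ∈ L) (hcard : 2 * k - 1 ≤ B.card)
    (hW : W ⊆ L ∪ R) (hWcov : ∀ p ∈ B, ∃ w ∈ W, p.2 < w ∧ w ≤ p.1) :
    ∃ w ∈ W, k ≤ (B.filter (fun p => p.2 < w ∧ w ≤ p.1)).card := by
  classical
  by_contra! hlt
  have card_covered_lt (S : Finset α) (hSW : S ⊆ W)
      (hS : S.Nonempty → ∃ m ∈ S, ∀ w ∈ S, ∀ p ∈ B, p.2 < w → w ≤ p.1 → p.2 < m ∧ m ≤ p.1) :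
      (B.filter (fun p => ∃ w ∈ S, p.2 < w ∧ w ≤ p.1)).card < k := by
    rcases S.eq_empty_or_nonempty with rfl | hne
    · simpa using Nat.pos_of_ne_zero (Nat.one_le_iff_ne_zero.1 hk)
    · obtain ⟨m, hm, hmax⟩ := hS hne
      refine (Finset.card_le_card ?_).trans_lt (hlt m (hSW hm))
      intro p hp
      obtain ⟨hpB, w, hw, hvw, hwu⟩ := Finset.mem_filter.1 hp
      exact Finset.mem_filter.2 ⟨hpB, hmax w hw p hpB hvw hwu⟩
  have hL := card_covered_lt (W ∩ L) Finset.inter_subset_left fun hne =>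
    ⟨(W ∩ L).max' hne, Finset.max'_mem _ hne, fun w hw p hp hvw _ =>
      ⟨hvw.trans_le (Finset.le_max' _ w hw),
        (hLR _ (Finset.mem_inter.1 (Finset.max'_mem _ hne)).2 _ (hB p hp).1).le⟩⟩
  have hR := card_covered_lt (W ∩ R) Finset.inter_subset_left fun hne =>
    ⟨(W ∩ R).min' hne, Finset.min'_mem _ hne, fun w hw p hp _ hwu =>
      ⟨hLR _ (hB p hp).2 _ (Finset.mem_inter.1 (Finset.min'_mem _ hne)).2,
        (Finset.min'_le _ w hw).trans hwu⟩⟩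
  have hsub : B ⊆ B.filter (fun p => ∃ w ∈ W ∩ L, p.2 < w ∧ w ≤ p.1) ∪
      B.filter (fun p => ∃ w ∈ W ∩ R, p.2 < w ∧ w ≤ p.1) := by
    intro p hp
    obtain ⟨w, hw, hcov⟩ := hWcov p hp
    rcases Finset.mem_union.1 (hW hw) with hwL | hwR
    · exact Finset.mem_union_left _
        (Finset.mem_filter.2 ⟨hp, w, Finset.mem_inter.2 ⟨hw, hwL⟩, hcov⟩)
    · exact Finset.mem_union_right _
        (Finset.mem_filter.2 ⟨hp, w, Finset.mem_inter.2 ⟨hw, hwR⟩, hcov⟩)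
  have hle := (Finset.card_le_card hsub).trans (Finset.card_union_le _ _)
  omega
end

section
/- Let ⪯ be a linear order (with corresponding strict order ≺) on a finite set L ∪ R, where L and R are disjoint and v ∈ L, u ∈ R imply v ≺ u. Let B be a set of at least 2k−1 ordered pairs (u,v) with u ∈ R and v ∈ L. Then there exists a pair (u,v) ∈ B such that there are at least k pairs (x,y) ∈ B with y ⪯ v, and at least k pairs (x,y) ∈ B with u ⪯ x. -/
variable {V : Type*} [DecidableEq V]

/-- Fewer than `k` elements of a finite set have fewer than `k` elements weakly below them
with respect to a function into a linear order. -/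
theorem card_filter_card_filter_le_lt {ι β : Type*} [LinearOrder β] (B : Finset ι) (f : ι → β)
    {k : ℕ} (hk : 1 ≤ k) :
    (B.filter (fun p => (B.filter (fun q => f q ≤ f p)).card < k)).card < k := by
  rcases (B.filter (fun p => (B.filter (fun q => f q ≤ f p)).card < k)).eq_empty_or_nonempty
    with h | h
  · rw [h, Finset.card_empty]
    exact hk
  · obtain ⟨m, hm, hmax⟩ := Finset.exists_max_image _ f h
    refine (Finset.card_le_card fun q hq => ?_).trans_lt (Finset.mem_filter.1 hm).2
    exact Finset.mem_filter.2 ⟨(Finset.mem_filter.1 hq).1, hmax q hq⟩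

/-- Let `⪯` be a linear order on the finite set `L ∪ R`, with `L`,
`R` disjoint and every element of `L` strictly below every element of `R`. Let
`B` be a set of at least `2k−1` pairs `(u,v)` with `u ∈ R`, `v ∈ L`. Then there
is a pair `(u,v) ∈ B` with at least `k` pairs `(x,y) ∈ B` with `y ⪯ v` and at
least `k` pairs `(x,y) ∈ B` with `u ⪯ x`. -/
theorem exists_middle_pair {α : Type*} [LinearOrder α] [DecidableEq α]
    (L R : Finset α) (B : Finset (α × α)) (k : ℕ) (hk : 1 ≤ k)
    (hdisj : Disjoint L R) (hLR : ∀ v ∈ L, ∀ u ∈ R, v < u)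
    (hB : ∀ p ∈ B, p.1 ∈ R ∧ p.2 ∈ L) (hcard : 2 * k - 1 ≤ B.card) :
    ∃ p ∈ B, k ≤ (B.filter (fun q => q.2 ≤ p.2)).card ∧
      k ≤ (B.filter (fun q => p.1 ≤ q.1)).card := by
  by_contra! h
  have h₁ := card_filter_card_filter_le_lt B Prod.snd hk
  have h₂ := card_filter_card_filter_le_lt B (fun p => OrderDual.toDual p.1) hk
  simp only [OrderDual.toDual_le_toDual] at h₂
  have hsub : B ⊆ B.filter (fun p => (B.filter (fun q => q.2 ≤ p.2)).card < k) ∪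
      B.filter (fun p => (B.filter (fun q => p.1 ≤ q.1)).card < k) := by
    intro p hp
    rw [Finset.mem_union, Finset.mem_filter, Finset.mem_filter]
    by_cases hpk : k ≤ (B.filter (fun q => q.2 ≤ p.2)).card
    · exact Or.inr ⟨hp, h p hp hpk⟩
    · exact Or.inl ⟨hp, not_le.1 hpk⟩
  have hle := (Finset.card_le_card hsub).trans (Finset.card_union_le _ _)
  omega
end

section
/- Let T be a 1-optimal out-branching of a finite digraph D with |Leaf(T)| ≤ k−1, and suppose that for all leaves l of T and all vertices x with x ⪯_T l it holds that |HB_D^T(x,l)| < 6k². Then the path decomposition (X_1,…,X_m) of the underlying undirected graph of D, defined by X_i = {v ∈ V(T) : h(v) = i} ∪ BrSucc(T) ∪ Leaf(T) ∪ {v ∈ V(T) : ∃ u ∈ R with h(v) < i ≤ h(u) and uv an edge of the underlying undirected graph of D}, where h(u) is the distance in T from the root to u, m is the maximum height, and R = (V(T)∖Leaf(T))∖BrSucc(T), has width at most 6k³. -/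
variable {V : Type*} [DecidableEq V]

section Height

variable {V : Type*} {T : Dgraph V} {h : V → ℕ}

lemma Dgraph.Reaches.height_le (hstep : ∀ a ∈ T.arcs, h a.2 = h a.1 + 1) {u v : V}
    (H : T.Reaches u v) : h u ≤ h v := by
  induction H with
  | refl => rfl
  | tail _ ha ih => exact ih.trans (by simpa using (hstep _ ha).ge.trans' (Nat.le_succ _))

lemma Dgraph.Reaches.eq_of_height_le (hstep : ∀ a ∈ T.arcs, h a.2 = h a.1 + 1) {u v : V}
    (H : T.Reaches u v) (hle : h v ≤ h u) : u = v := by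
  cases H with
  | refl => rfl
  | tail H ha =>
    have := Dgraph.Reaches.height_le hstep H
    have := hstep _ ha
    dsimp only at this
    omega

lemma Dgraph.Reaches.exists_height_eq (hstep : ∀ a ∈ T.arcs, h a.2 = h a.1 + 1) {u v : V}
    (H : T.Reaches u v) {i : ℕ} (hu : h u ≤ i) (hv : i ≤ h v) :
    ∃ z, T.Reaches u z ∧ T.Reaches z v ∧ h z = i := by
  induction H with
  | refl => exact ⟨u, .refl, .refl, hu.antisymm hv⟩
  | @tail b c H ha ih =>
    have hs := hstep _ ha
    dsimp only at hs
    by_cases hb : i ≤ h b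
    · obtain ⟨z, h1, h2, h3⟩ := ih hb
      exact ⟨z, h1, h2.tail ha, h3⟩
    · exact ⟨c, H.tail ha, .refl, by omega⟩

end Height

section OutTree

variable {V : Type*} [DecidableEq V] {D T : Dgraph V} {r : V} {h : V → ℕ}

lemma exists_arc_of_notMem_leaves {u : V} (hu : u ∈ T.verts) (hl : u ∉ leaves T) :
    ∃ c, (u, c) ∈ T.arcs := by
  have hne : outDeg T u ≠ 0 := fun h0 => hl (Finset.mem_filter.2 ⟨hu, h0⟩)
  obtain ⟨⟨a, c⟩, ha⟩ := Finset.card_ne_zero.1 hne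
  obtain ⟨hac, rfl⟩ := Finset.mem_filter.1 ha
  exact ⟨c, hac⟩

lemma mem_leaves_iff {u : V} : u ∈ leaves T ↔ u ∈ T.verts ∧ ∀ c, (u, c) ∉ T.arcs := by
  simp only [leaves, outDeg, Finset.mem_filter, Finset.card_eq_zero, Finset.filter_eq_empty_iff]
  refine and_congr_right fun _ => ⟨fun H c hc => H hc rfl, ?_⟩
  rintro H ⟨a, c⟩ hc rfl
  exact H c hc

lemma IsOutTree.ne_root_of_arc (hT : IsOutTree T r) {a v : V} (ha : (a, v) ∈ T.arcs) :
    v ≠ r := by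
  rintro rfl
  have h0 := hT.2.2.1
  rw [inDeg, Finset.card_eq_zero, Finset.filter_eq_empty_iff] at h0
  exact h0 ha rfl

lemma IsOutTree.parent_unique (hT : IsOutTree T r) {a b v : V} (ha : (a, v) ∈ T.arcs)
    (hb : (b, v) ∈ T.arcs) : a = b := by
  have h1 := hT.2.2.2.1 v (hT.1 _ ha).2 (hT.ne_root_of_arc ha)
  have := Finset.card_le_one.1 h1.le (a, v) (by simp [ha]) (b, v) (by simp [hb])
  exact congrArg Prod.fst this

lemma IsOutTree.exists_parent (hT : IsOutTree T r) {v : V} (hv : v ∈ T.verts) (hr : v ≠ r) :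
    ∃ w, (w, v) ∈ T.arcs := by
  have h1 := hT.2.2.2.1 v hv hr
  obtain ⟨⟨a, c⟩, ha⟩ := Finset.card_ne_zero.1 (h1.trans_ne one_ne_zero)
  obtain ⟨hac, rfl⟩ := Finset.mem_filter.1 ha
  exact ⟨a, hac⟩

lemma IsOutTree.card_arcs_le (hT : IsOutTree T r) : T.arcs.card ≤ T.verts.card := by
  refine Finset.card_le_card_of_injOn Prod.snd (fun a ha => (hT.1 a ha).2) ?_
  rintro ⟨a, v⟩ ha ⟨b, w⟩ hb (rfl : v = w)
  rw [hT.parent_unique ha hb]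

lemma IsOutTree.eq_of_reaches_of_height_eq (hT : IsOutTree T r)
    (hstep : ∀ a ∈ T.arcs, h a.2 = h a.1 + 1) {y z l : V} (hy : T.Reaches y l)
    (hz : T.Reaches z l) (hyz : h y = h z) : y = z := by
  have key : T.Reaches y z ∨ T.Reaches z y := by
    have := Relation.ReflTransGen.total_of_right_unique
      (r := Function.swap fun a b => (a, b) ∈ T.arcs)
      (fun _ _ _ ha hb => hT.parent_unique ha hb) hy.swap hz.swap
    exact this.symm.imp Relation.reflTransGen_swap.1 Relation.reflTransGen_swap.1
  rcases key with H | H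
  · exact H.eq_of_height_le hstep hyz.ge
  · exact (H.eq_of_height_le hstep hyz.le).symm

lemma IsOutTree.exists_leaf (hT : IsOutTree T r)
    (hstep : ∀ a ∈ T.arcs, h a.2 = h a.1 + 1) {v : V} (hv : v ∈ T.verts) :
    ∃ l ∈ leaves T, T.Reaches v l := by
  classical
  obtain ⟨l, hl, hmax⟩ := (T.verts.filter fun x => T.Reaches v x).exists_max_image h
    ⟨v, Finset.mem_filter.2 ⟨hv, .refl⟩⟩
  obtain ⟨hl, hvl⟩ := Finset.mem_filter.1 hl
  refine ⟨l, mem_leaves_iff.2 ⟨hl, fun c hc => ?_⟩, hvl⟩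
  have := hmax c (Finset.mem_filter.2 ⟨(hT.1 _ hc).2, hvl.tail hc⟩)
  have := hstep _ hc
  dsimp only at this
  omega

/-- Each level of an out-tree is an antichain, so it is no larger than the set of leaves. -/
lemma IsOutTree.card_level_le (hT : IsOutTree T r)
    (hstep : ∀ a ∈ T.arcs, h a.2 = h a.1 + 1) (i : ℕ) :
    (T.verts.filter fun v => h v = i).card ≤ (leaves T).card := by
  have H : ∀ v ∈ T.verts.filter fun v => h v = i, ∃ l ∈ leaves T, T.Reaches v l :=
    fun v hv => hT.exists_leaf hstep (Finset.mem_filter.1 hv).1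
  choose! f hf hr using H
  refine Finset.card_le_card_of_injOn f hf fun x hx y hy hxy => ?_
  refine hT.eq_of_reaches_of_height_eq hstep (hr x hx) (hxy ▸ hr y hy) ?_
  rw [(Finset.mem_filter.1 hx).2, (Finset.mem_filter.1 hy).2]

lemma IsOutTree.card_brSucc_le (hT : IsOutTree T r) :
    (brSucc T).card ≤ 2 * (leaves T).card := by
  set B := T.arcs.filter fun a => 2 ≤ outDeg T a.1
  have hB : (brSucc T).card ≤ B.card := by
    refine (Finset.card_le_card (t := B.image Prod.snd) fun v hv => ?_).trans
      Finset.card_image_le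
    obtain ⟨-, a, ha, hav, h2⟩ := Finset.mem_filter.1 hv
    exact Finset.mem_image.2 ⟨a, Finset.mem_filter.2 ⟨ha, h2⟩, hav⟩
  have hA : T.arcs.card = ∑ v ∈ T.verts, outDeg T v :=
    Finset.card_eq_sum_card_fiberwise fun a ha => (hT.1 a ha).1
  have hBs : B.card = ∑ v ∈ T.verts, (B.filter fun a => a.1 = v).card :=
    Finset.card_eq_sum_card_fiberwise fun a ha => (hT.1 a (Finset.mem_filter.1 ha).1).1
  have hL : (leaves T).card = ∑ v ∈ T.verts, if outDeg T v = 0 then 1 else 0 :=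
    Finset.card_filter _ _
  have key : ∑ v ∈ T.verts, ((B.filter fun a => a.1 = v).card + 2) ≤
      ∑ v ∈ T.verts, (2 * outDeg T v + 2 * if outDeg T v = 0 then 1 else 0) := by
    refine Finset.sum_le_sum fun v _ => ?_
    have h1 : (B.filter fun a => a.1 = v).card ≤ outDeg T v :=
      Finset.card_le_card (Finset.filter_subset_filter _ (Finset.filter_subset _ _))
    by_cases h2 : 2 ≤ outDeg T v
    · omega
    · have h3 : B.filter (fun a => a.1 = v) = ∅ := by
        refine Finset.filter_eq_empty_iff.2 fun a ha hav => h2 ?_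
        exact hav ▸ (Finset.mem_filter.1 ha).2
      rw [h3, Finset.card_empty]
      split_ifs <;> omega
  rw [Finset.sum_add_distrib, Finset.sum_add_distrib, ← Finset.mul_sum, ← Finset.mul_sum, ← hA,
    ← hBs, ← hL, Finset.sum_const, smul_eq_mul] at key
  have := hT.card_arcs_le
  omega

lemma mem_oneChange_arcs {u v w : V} {a : V × V} :
    a ∈ (oneChange T u v w).arcs ↔ a = (u, v) ∨ a ≠ (w, v) ∧ a ∈ T.arcs := by
  simp [oneChange]

lemma IsOutBranching.oneChange (hT : IsOutBranching D T r) (hwf : DgraphWF D)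
    (hstep : ∀ a ∈ T.arcs, h a.2 = h a.1 + 1) {u v w : V} (huv : (u, v) ∈ D.arcs)
    (hvr : v ≠ r) (hw : (w, v) ∈ T.arcs) (hvu : ¬ T.Reaches v u) :
    IsOutBranching D (oneChange T u v w) r := by
  obtain ⟨hsub, hverts, hT⟩ := hT
  have hu : u ∈ T.verts := hverts ▸ (hwf _ huv).1
  have hvv : v ∈ T.verts := hverts ▸ (hwf _ huv).2
  have keep : ∀ {b c}, (b, c) ∈ T.arcs → c ≠ v → (b, c) ∈ (_root_.oneChange T u v w).arcs :=
    fun hbc hcv => mem_oneChange_arcs.2 (.inr ⟨fun e => hcv (congrArg Prod.snd e), hbc⟩)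
  have outside : ∀ {x}, T.Reaches r x → ¬ T.Reaches v x →
      (_root_.oneChange T u v w).Reaches r x := by
    intro x hx
    induction hx with
    | refl => exact fun _ => .refl
    | tail _ ha ih =>
      intro hvc
      exact (ih fun hvb => hvc (hvb.tail ha)).tail
        (keep ha (by rintro rfl; exact hvc .refl))
  have inside : ∀ {x}, T.Reaches v x → (_root_.oneChange T u v w).Reaches v x := by
    intro x hx
    induction hx with
    | refl => exact .refl
    | tail hb ha ih =>
      refine ih.tail (keep ha ?_)
      rintro rfl
      have := Dgraph.Reaches.height_le hstep hb
      have := hstep _ ha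
      dsimp only at this
      omega
  have reach_v : (_root_.oneChange T u v w).Reaches r v :=
    (outside (hT.2.2.2.2 u hu) hvu).tail (mem_oneChange_arcs.2 (.inl rfl))
  have inDeg_eq : ∀ x, x ≠ v → inDeg (_root_.oneChange T u v w) x = inDeg T x := by
    intro x hx
    refine congrArg Finset.card (Finset.ext ?_)
    rintro ⟨b, c⟩
    simp only [Finset.mem_filter, mem_oneChange_arcs]
    grind
  refine ⟨⟨hsub.1, fun a ha => ?_⟩, hverts, fun a ha => ?_, hT.2.1, ?_, fun x hx hxr => ?_,
    fun x hx => ?_⟩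
  · rcases mem_oneChange_arcs.1 ha with rfl | ⟨-, ha⟩
    exacts [huv, hsub.2 ha]
  · rcases mem_oneChange_arcs.1 ha with rfl | ⟨-, ha⟩
    exacts [⟨hu, hvv⟩, hT.1 a ha]
  · rw [inDeg_eq r hvr.symm, hT.2.2.1]
  · by_cases hxv : x = v
    · subst hxv
      refine Finset.card_eq_one.2 ⟨(u, x), Finset.ext ?_⟩
      rintro ⟨b, c⟩
      simp only [Finset.mem_filter, mem_oneChange_arcs, Finset.mem_singleton]
      have := fun hb => hT.parent_unique (a := b) hb hw
      grind
    · rw [inDeg_eq x hxv, hT.2.2.2.1 x hx hxr]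
  · by_cases hvx : T.Reaches v x
    · exact reach_v.trans (inside hvx)
    · exact outside (hT.2.2.2.2 x hx) hvx

lemma card_leaves_lt_card_leaves_oneChange (hT : IsOutTree T r) {u v w : V}
    (hu : u ∈ T.verts) (hul : u ∉ leaves T) (huv : (u, v) ∉ T.arcs) (hw : (w, v) ∈ T.arcs)
    (hv : v ∉ brSucc T) : (leaves T).card < (leaves (oneChange T u v w)).card := by
  obtain ⟨c, hc⟩ := exists_arc_of_notMem_leaves hu hul
  have hdeg : outDeg T w ≤ 1 := by
    by_contra hlt
    exact hv (Finset.mem_filter.2 ⟨(hT.1 _ hw).2, (w, v), hw, rfl, by dsimp only; omega⟩)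
  have huniq : ∀ d, (w, d) ∈ T.arcs → (w, d) = (w, v) := fun d hd =>
    Finset.card_le_one.1 hdeg (w, d) (by simp [hd]) (w, v) (by simp [hw])
  refine Finset.card_lt_card (Finset.ssubset_iff.2
    ⟨w, fun hwl => (mem_leaves_iff.1 hwl).2 v hw, fun y hy => ?_⟩)
  refine mem_leaves_iff.2 ?_
  rcases Finset.mem_insert.1 hy with rfl | hy
  · refine ⟨(hT.1 _ hw).1, fun d hd => ?_⟩
    rcases mem_oneChange_arcs.1 hd with he | ⟨hne, hd⟩
    · obtain rfl : y = u := congrArg Prod.fst he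
      exact huv hw
    · exact hne (huniq d hd)
  · obtain ⟨hy, hyl⟩ := mem_leaves_iff.1 hy
    refine ⟨hy, fun d hd => ?_⟩
    rcases mem_oneChange_arcs.1 hd with he | ⟨-, hd⟩
    · obtain rfl : y = u := congrArg Prod.fst he
      exact hyl c hc
    · exact hyl d hd

/-- In a 1-optimal out-branching, an arc outside the tree that leaves an inner vertex either goes
to an ancestor of its tail or enters a successor of a branch vertex. -/
lemma OneOptimal.reaches_or_mem_brSucc (hopt : OneOptimal D T r) (hT : IsOutBranching D T r)
    (hwf : DgraphWF D) (hstep : ∀ a ∈ T.arcs, h a.2 = h a.1 + 1) {u v : V}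
    (huv : (u, v) ∈ D.arcs) (huvT : (u, v) ∉ T.arcs) (hul : u ∉ leaves T) :
    T.Reaches v u ∨ v ∈ brSucc T := by
  by_contra! H
  obtain ⟨hvu, hvb⟩ := H
  have hu : u ∈ T.verts := hT.2.1 ▸ (hwf _ huv).1
  have hv : v ∈ T.verts := hT.2.1 ▸ (hwf _ huv).2
  have hvr : v ≠ r := by
    rintro rfl
    exact hvu (hT.2.2.2.2.2.2 u hu)
  obtain ⟨w, hw⟩ := hT.2.2.exists_parent hv hvr
  exact (hopt u v w huv huvT hvr hw r (hT.oneChange hwf hstep huv hvr hw hvu)).not_gt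
    (card_leaves_lt_card_leaves_oneChange hT.2.2 hu hul huvT hw hvb)

lemma IsOutTree.card_biUnion_HBset_le (hT : IsOutTree T r)
    (hstep : ∀ a ∈ T.arcs, h a.2 = h a.1 + 1) {b : ℕ}
    (hHB : ∀ l ∈ leaves T, ∀ x : V, T.Reaches x l → (HBset D T x l).card ≤ b) (i : ℕ) :
    ∃ S : Finset V, S.card ≤ (leaves T).card * b ∧
      ∀ l ∈ leaves T, ∀ z, T.Reaches z l → h z = i → HBset D T z l ⊆ S := by
  have H : ∀ l ∈ leaves T, ∃ A : Finset V, A.card ≤ b ∧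
      ∀ z, T.Reaches z l → h z = i → HBset D T z l ⊆ A := by
    intro l hl
    by_cases hz : ∃ z, T.Reaches z l ∧ h z = i
    · obtain ⟨z, hzl, hzi⟩ := hz
      refine ⟨HBset D T z l, hHB l hl z hzl, fun y hyl hyi => ?_⟩
      rw [hT.eq_of_reaches_of_height_eq hstep hyl hzl (hyi.trans hzi.symm)]
    · exact ⟨∅, by simp, fun z hzl hzi => (hz ⟨z, hzl, hzi⟩).elim⟩
  choose! A hA hsub using H
  exact ⟨(leaves T).biUnion A, Finset.card_biUnion_le_card_mul _ _ _ hA,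
    fun l hl z hzl hzi => (hsub l hl z hzl hzi).trans (Finset.subset_biUnion_of_mem A hl)⟩

end OutTree

/-- Let `T` be a 1-optimal out-branching of a finite digraph `D`
with `|Leaf(T)| ≤ k−1`, and suppose `|HB_D^T(x,l)| < 6k²` for all leaves `l` of
`T` and all `x ⪯_T l`. Then every bag `X_i` of the path decomposition defined
in the paper has size at most `6k³ + 1`, i.e. the width is at most `6k³`. -/
theorem bags_bounded_width {V : Type*} [DecidableEq V]
    (D T : Dgraph V) (r : V) (k : ℕ) (hk : 1 ≤ k) (hwf : DgraphWF D)
    (hT : IsOutBranching D T r) (hopt : OneOptimal D T r)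
    (hleaves : (leaves T).card ≤ k - 1)
    (hHB : ∀ l ∈ leaves T, ∀ x : V, T.Reaches x l →
      (HBset D T x l).card < 6 * k ^ 2)
    (h : V → ℕ) (hr0 : h r = 0) (hstep : ∀ a ∈ T.arcs, h a.2 = h a.1 + 1)
    (m : ℕ) (hm : m = T.verts.sup h)
    (X : ℕ → Finset V)
    (hX : ∀ i, X i =
      (T.verts.filter (fun v => h v = i)) ∪ brSucc T ∪ leaves T ∪
      (T.verts.filter (fun v => ∃ u ∈ T.verts,
        u ∉ leaves T ∧ u ∉ brSucc T ∧ h v < i ∧ i ≤ h u ∧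
        ((u, v) ∈ D.arcs ∨ (v, u) ∈ D.arcs)))) :
    ∀ i, 1 ≤ i → i ≤ m → (X i).card ≤ 6 * k ^ 3 + 1 := by
  intro i hi _
  have hTree := hT.2.2
  obtain ⟨S, hScard, hS⟩ := hTree.card_biUnion_HBset_le hstep (D := D)
    (fun l hl x hx => Nat.le_sub_one_of_lt (hHB l hl x hx)) i
  have hsub : X i ⊆ T.verts.filter (fun v => h v = i) ∪ brSucc T ∪ leaves T ∪
      (T.verts.filter (fun v => h v = i - 1) ∪ S) := by
    rw [hX]
    refine Finset.union_subset Finset.subset_union_left fun v hv => ?_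
    obtain ⟨hv, u, hu, hul, hub, hvi, hiu, harc⟩ := Finset.mem_filter.1 hv
    simp only [Finset.mem_union, Finset.mem_filter]
    rcases harc with harc | harc
    · have harcT : (u, v) ∉ T.arcs := fun ha => by
        have := hstep _ ha
        dsimp only at this
        omega
      rcases hopt.reaches_or_mem_brSucc hT hwf hstep harc harcT hul with hvu | hvb
      · by_cases hvb : v ∈ brSucc T
        · exact .inl (.inl (.inr hvb))
        obtain ⟨z, hvz, hzu, hzi⟩ := hvu.exists_height_eq hstep hvi.le hiu
        obtain ⟨l, hl, hlu⟩ := hTree.exists_leaf hstep hu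
        refine .inr (.inr (hS l hl z (hzu.trans hlu) hzi ?_))
        simp only [HBset, Finset.mem_sdiff, Finset.mem_image, Finset.mem_filter]
        refine ⟨⟨(u, v), ⟨harc, ⟨hvz, ?_⟩, hzu, hlu⟩, rfl⟩, hvb⟩
        rintro rfl
        exact hvi.ne hzi
      · exact .inl (.inl (.inr hvb))
    · by_cases hvl : v ∈ leaves T
      · exact .inl (.inr hvl)
      by_cases harcT : (v, u) ∈ T.arcs
      · have := hstep _ harcT
        dsimp only at this
        exact .inr (.inl ⟨hv, by omega⟩)
      · rcases hopt.reaches_or_mem_brSucc hT hwf hstep harc harcT hvl with huv | hub'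
        · have := huv.height_le hstep
          omega
        · exact (hub hub').elim
  have h1 := hTree.card_level_le hstep i
  have h2 := hTree.card_level_le hstep (i - 1)
  have h3 := hTree.card_brSucc_le
  have hcard : (X i).card ≤ 5 * (leaves T).card + (leaves T).card * (6 * k ^ 2 - 1) := by
    refine (Finset.card_le_card hsub).trans ?_
    have c1 := Finset.card_union_le (T.verts.filter (fun v => h v = i)) (brSucc T)
    have c2 := Finset.card_union_le (T.verts.filter (fun v => h v = i) ∪ brSucc T) (leaves T)
    have c3 := Finset.card_union_le (T.verts.filter (fun v => h v = i) ∪ brSucc T ∪ leaves T)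
      (T.verts.filter (fun v => h v = i - 1) ∪ S)
    have c4 := Finset.card_union_le (T.verts.filter (fun v => h v = i - 1)) S
    omega
  refine hcard.trans ?_
  obtain ⟨j, rfl⟩ : ∃ j, k = j + 1 := ⟨k - 1, by omega⟩
  rw [Nat.add_sub_cancel] at hleaves
  obtain ⟨b, hb⟩ : ∃ b, 6 * (j + 1) ^ 2 = b + 1 :=
    Nat.exists_eq_succ_of_ne_zero (by positivity)
  rw [hb, Nat.add_sub_cancel]
  have := Nat.mul_le_mul_right b hleaves
  nlinarith
end
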